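/- Fix λ₁, λ₂ ∈ ℂ with λ₁·λ₂·(λ₁−λ₂) ≠ 0. For each of the four pairs (A,B) with A ∈ {Φ_{λ₁}, W^r_{λ₁}} and B ∈ {Φ_{λ₂}, W^r_{λ₂}}, the function F⁺_{A,B} on V defined by F⁺_{A,B}(Y,Z) = (A(ν₁)·B(ν₂) + A(ν₂)·B(ν₁))/|ν₁ − ν₂| when S₀ > 0 and S ≠ 0, and by 0 otherwise, is locally integrable on all of V with respect to Lebesgue measure. -/

import Mathlib

open MeasureTheory

/-- The entire function `Φ_λ(z) = Σ_{n≥0} (λz)ⁿ/(4ⁿ (n!)²)`. -/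
noncomputable def Phi (lam z : ℂ) : ℂ :=
  ∑' n : ℕ, (lam * z) ^ n / (4 ^ n * (n.factorial : ℂ) ^ 2)

/-- `a(n) = −2 Γ′(n+1)/Γ(n+1)` where `Γ` is the real Gamma function. -/
noncomputable def aCoef (n : ℕ) : ℝ :=
  -2 * deriv Real.Gamma ((n : ℝ) + 1) / Real.Gamma ((n : ℝ) + 1)

/-- The entire function `w_λ(z) = Σ_{n≥0} a(n) (λz)ⁿ/(4ⁿ (n!)²)`. -/
noncomputable def wFun (lam z : ℂ) : ℂ :=
  ∑' n : ℕ, (aCoef n : ℂ) * (lam * z) ^ n / (4 ^ n * (n.factorial : ℂ) ^ 2)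

/-- `W^r_λ(t) = w_λ(t) + log|t| Φ_λ(t)` for real `t`. -/
noncomputable def Wr (lam : ℂ) (t : ℝ) : ℂ :=
  wFun lam t + (Real.log |t| : ℂ) * Phi lam t

/-- The space `V = M₂(ℝ) × M₂(ℝ)` of pairs of 2×2 real matrices. -/
abbrev V : Type := (Fin 2 → Fin 2 → ℝ) × (Fin 2 → Fin 2 → ℝ)

/-- `Q = tr(YZ)`. -/
noncomputable def Qf (p : V) : ℝ := (Matrix.of p.1 * Matrix.of p.2).trace

/-- `S = det Y · det Z`. -/
noncomputable def Sf (p : V) : ℝ := (Matrix.of p.1).det * (Matrix.of p.2).det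

/-- `S₀ = Q² − 4S`. -/
noncomputable def S0f (p : V) : ℝ := Qf p ^ 2 - 4 * Sf p

/-- `ν₁ = (Q + √S₀)/2` (real, used when `S₀ > 0`). -/
noncomputable def nu1r (p : V) : ℝ := (Qf p + Real.sqrt (S0f p)) / 2

/-- `ν₂ = (Q − √S₀)/2` (real, used when `S₀ > 0`). -/
noncomputable def nu2r (p : V) : ℝ := (Qf p - Real.sqrt (S0f p)) / 2

/-- The open set `𝒰`, complement of the nilpotent cone: `(Q,S) ≠ (0,0)`. -/
def U : Set V := {p | ¬(Qf p = 0 ∧ Sf p = 0)}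

open scoped ENNReal

/-- The `[0, ∞]`-valued weight `|x| ^ (-2/3)`, equal to `∞` at `x = 0`. -/
noncomputable def negPow (x : ℝ) : ℝ≥0∞ := ENNReal.ofReal |x| ^ (-(2 / 3) : ℝ)

@[fun_prop]
lemma measurable_negPow : Measurable negPow := by
  unfold negPow
  fun_prop

lemma negPow_mul (x y : ℝ) : negPow (x * y) = negPow x * negPow y := by
  unfold negPow
  rw [abs_mul, ENNReal.ofReal_mul (abs_nonneg x),
    ENNReal.mul_rpow_of_ne_top ENNReal.ofReal_ne_top ENNReal.ofReal_ne_top]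

lemma negPow_of_ne_zero {x : ℝ} (hx : x ≠ 0) :
    negPow x = ENNReal.ofReal (|x| ^ (-(2 / 3) : ℝ)) :=
  ENNReal.ofReal_rpow_of_pos (abs_pos.2 hx)

lemma negPow_le_one {x : ℝ} (hx : 1 ≤ |x|) : negPow x ≤ 1 :=
  ENNReal.rpow_le_one_of_one_le_of_neg (ENNReal.one_le_ofReal.2 hx) (by norm_num)

lemma lintegral_negPow_lt_top : ∫⁻ u in Set.Icc (-1 : ℝ) 1, negPow u < ∞ := by
  have h1 : IntegrableOn (fun u : ℝ => |u| ^ (-(2 / 3) : ℝ)) (Set.Ioc (-1) 1) := by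
    have h0 : IntervalIntegrable (fun u : ℝ => |u| ^ (-(2 / 3) : ℝ)) volume 0 1 := by
      refine (intervalIntegral.intervalIntegrable_rpow' (r := -(2 / 3)) (by norm_num)).congr ?_
      intro u hu
      rw [Set.uIoc_of_le zero_le_one] at hu
      simp [abs_of_pos hu.1]
    have h2 : IntervalIntegrable (fun u : ℝ => |u| ^ (-(2 / 3) : ℝ)) volume (-1) 0 := by
      simpa using (h0.comp_sub_left 0).symm
    exact (intervalIntegrable_iff_integrableOn_Ioc_of_le (by norm_num)).1 (h2.trans h0)
  rw [← setLIntegral_congr Ioc_ae_eq_Icc]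
  refine lt_of_eq_of_lt (lintegral_congr_ae (ae_restrict_of_ae ?_)) h1.2
  filter_upwards [compl_mem_ae_iff.2 (measure_singleton (0 : ℝ))] with u hu
  rw [negPow_of_ne_zero hu, Real.enorm_eq_ofReal (by positivity)]

/-- A constant bounding `∫ t in 0..1, |a + t| ^ (-2/3)` for all `a`. -/
noncomputable def negPowBound : ℝ≥0∞ := 1 + ∫⁻ u in Set.Icc (-1 : ℝ) 1, negPow u

lemma lintegral_negPow_add_le (a : ℝ) :
    ∫⁻ t in Set.Icc (0 : ℝ) 1, negPow (a + t) ≤ negPowBound := by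
  have hle : ∀ x, negPow x ≤ 1 + (Set.Icc (-1 : ℝ) 1).indicator negPow x := by
    intro x
    by_cases hx : x ∈ Set.Icc (-1 : ℝ) 1
    · simp [hx]
    · have : 1 ≤ |x| := by
        by_contra! h
        exact hx ⟨(abs_lt.1 h).1.le, (abs_lt.1 h).2.le⟩
      exact (negPow_le_one this).trans le_self_add
  calc ∫⁻ t in Set.Icc (0 : ℝ) 1, negPow (a + t)
      ≤ ∫⁻ t in Set.Icc (0 : ℝ) 1, (1 + (Set.Icc (-1 : ℝ) 1).indicator negPow (a + t)) :=
        lintegral_mono fun t => hle _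
    _ = 1 + ∫⁻ t in Set.Icc (0 : ℝ) 1, (Set.Icc (-1 : ℝ) 1).indicator negPow (a + t) := by
        rw [lintegral_add_left measurable_const]
        simp
    _ ≤ 1 + ∫⁻ t, (Set.Icc (-1 : ℝ) 1).indicator negPow (a + t) := by
        gcongr
        exact Measure.restrict_le_self
    _ = negPowBound := by
        rw [lintegral_add_left_eq_self (μ := volume)
            (fun x => (Set.Icc (-1 : ℝ) 1).indicator negPow x) a,
          lintegral_indicator measurableSet_Icc]
        rfl

lemma lintegral_negPow_affine_le (a b : ℝ) :
    ∫⁻ t in Set.Icc (0 : ℝ) 1, negPow (a + t * b) ≤ negPowBound * negPow b := by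
  rcases eq_or_ne b 0 with rfl | hb
  · have : negPow 0 = ∞ := by simp [negPow]
    rw [this, ENNReal.mul_top (by simp [negPowBound])]
    exact le_top
  · have : ∀ t : ℝ, negPow (a + t * b) = negPow (a / b + t) * negPow b := by
      intro t
      rw [← negPow_mul]
      congr 1
      field_simp
    simp_rw [this]
    rw [lintegral_mul_const _ (by fun_prop)]
    gcongr
    exact lintegral_negPow_add_le _

/-- `|P| ^ (-2/3)` has finite integral over every ball. -/
def NegPowLocInt (P : V → ℝ) : Prop :=
  ∀ R : ℝ, ∫⁻ p in Metric.closedBall (0 : V) R, negPow (P p) < ∞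

/-- If `P` is affine with slope `P'` along the orbits of a measure-preserving flow
`p ↦ p + t • v p`, then local integrability of `|P'| ^ (-2/3)` implies that of
`|P| ^ (-2/3)`. -/
lemma NegPowLocInt.of_flow {P P' : V → ℝ} {v : V → V} (hP : Measurable P)
    (hv : Continuous v) (hmp : ∀ t : ℝ, MeasurePreserving (fun p : V => p + t • v p))
    (hinv : ∀ (t : ℝ) (p : V), v (p + t • v p) = v p)
    (hslope : ∀ (t : ℝ) (p : V), P (p + t • v p) = P p + t * P' p)
    (hP' : NegPowLocInt P') : NegPowLocInt P := by
  intro R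
  obtain ⟨K, hK⟩ := (isCompact_closedBall (0 : V) R).exists_bound_of_continuousOn hv.continuousOn
  have hsub : ∀ t ∈ Set.Icc (0 : ℝ) 1,
      (fun p : V => p + t • v p) ⁻¹' Metric.closedBall 0 R ⊆ Metric.closedBall 0 (R + K) := by
    intro t ht p hp
    have h1 : ‖v p‖ ≤ K := by simpa [hinv] using hK _ hp
    have h2 : ‖p + t • v p‖ ≤ R := by simpa using hp
    have h3 : ‖t • v p‖ ≤ K := by
      rw [norm_smul, Real.norm_of_nonneg ht.1]
      exact (mul_le_of_le_one_left (norm_nonneg _) ht.2).trans h1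
    rw [mem_closedBall_zero_iff]
    calc ‖p‖ = ‖(p + t • v p) - t • v p‖ := by simp
      _ ≤ R + K := (norm_sub_le _ _).trans (add_le_add h2 h3)
  have hm : Measurable fun q : V × ℝ => negPow (P (q.1 + q.2 • v q.1)) := by
    refine measurable_negPow.comp (hP.comp ?_)
    exact (by fun_prop : Continuous fun q : V × ℝ => q.1 + q.2 • v q.1).measurable
  have key : ∀ t ∈ Set.Icc (0 : ℝ) 1, ∫⁻ p in Metric.closedBall (0 : V) R, negPow (P p) ≤
      ∫⁻ p in Metric.closedBall (0 : V) (R + K), negPow (P (p + t • v p)) := by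
    intro t ht
    have h := (hmp t).setLIntegral_comp_preimage
      (Metric.isClosed_closedBall (x := (0 : V)) (ε := R)).measurableSet (measurable_negPow.comp hP)
    exact h.symm.trans_le (lintegral_mono_set (hsub t ht))
  calc ∫⁻ p in Metric.closedBall (0 : V) R, negPow (P p)
      = ∫⁻ _ in Set.Icc (0 : ℝ) 1, ∫⁻ p in Metric.closedBall (0 : V) R, negPow (P p) := by simp
    _ ≤ ∫⁻ t in Set.Icc (0 : ℝ) 1,
          ∫⁻ p in Metric.closedBall (0 : V) (R + K), negPow (P (p + t • v p)) :=
        setLIntegral_mono' measurableSet_Icc key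
    _ = ∫⁻ p in Metric.closedBall (0 : V) (R + K),
          ∫⁻ t in Set.Icc (0 : ℝ) 1, negPow (P (p + t • v p)) :=
        (lintegral_lintegral_swap hm.aemeasurable).symm
    _ ≤ ∫⁻ p in Metric.closedBall (0 : V) (R + K), negPowBound * negPow (P' p) := by
        refine lintegral_mono fun p => ?_
        simp_rw [hslope]
        exact lintegral_negPow_affine_le _ _
    _ = negPowBound * ∫⁻ p in Metric.closedBall (0 : V) (R + K), negPow (P' p) :=
        lintegral_const_mul' _ _ (by
          exact (ENNReal.add_lt_top.2 ⟨ENNReal.one_lt_top, lintegral_negPow_lt_top⟩).ne)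
    _ < ∞ := ENNReal.mul_lt_top
        (ENNReal.add_lt_top.2 ⟨ENNReal.one_lt_top, lintegral_negPow_lt_top⟩) (hP' _)

lemma NegPowLocInt.const {c : ℝ} (hc : c ≠ 0) : NegPowLocInt fun _ => c := by
  intro R
  rw [lintegral_const, negPow_of_ne_zero hc]
  refine ENNReal.mul_lt_top ENNReal.ofReal_lt_top ?_
  rw [Measure.restrict_apply_univ]
  exact measure_closedBall_lt_top

instance : (volume : Measure V).IsAddRightInvariant :=
  Measure.prod.instIsAddRightInvariant

lemma NegPowLocInt.of_translation {P P' : V → ℝ} (e : V) (hP : Measurable P)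
    (hslope : ∀ (t : ℝ) (p : V), P (p + t • e) = P p + t * P' p)
    (hP' : NegPowLocInt P') : NegPowLocInt P :=
  hP'.of_flow (v := fun _ => e) hP continuous_const
    (fun t => measurePreserving_add_right volume (t • e)) (fun _ _ => rfl) hslope

lemma measurePreserving_shear {v : (Fin 2 → Fin 2 → ℝ) → (Fin 2 → Fin 2 → ℝ)}
    (hv : Continuous v) (t : ℝ) :
    MeasurePreserving (fun p : V => p + t • ((v p.2, 0) : V)) := by
  have h1 : MeasurePreserving
      (fun q : (Fin 2 → Fin 2 → ℝ) × (Fin 2 → Fin 2 → ℝ) => (q.1, q.2 + t • v q.1)) :=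
    (MeasurePreserving.id volume).skew_product (g := fun z y => y + t • v z)
      (by fun_prop)
      (Filter.Eventually.of_forall fun z => (measurePreserving_add_right volume (t • v z)).map_eq)
  have h2 := (Measure.measurePreserving_swap.comp h1).comp
    (Measure.measurePreserving_swap (μ := (volume : Measure (Fin 2 → Fin 2 → ℝ)))
      (ν := (volume : Measure (Fin 2 → Fin 2 → ℝ))))
  convert h2 using 1
  ext p <;> simp
  all_goals rfl

lemma Qf_eq (p : V) : Qf p = p.1 0 0 * p.2 0 0 + p.1 0 1 * p.2 1 0 +
    (p.1 1 0 * p.2 0 1 + p.1 1 1 * p.2 1 1) := by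
  simp [Qf, Matrix.trace, Matrix.mul_apply, Fin.sum_univ_two]

lemma Sf_eq (p : V) : Sf p = (p.1 0 0 * p.1 1 1 - p.1 0 1 * p.1 1 0) *
    (p.2 0 0 * p.2 1 1 - p.2 0 1 * p.2 1 0) := by
  simp [Sf, Matrix.det_fin_two]

lemma continuous_Qf : Continuous Qf := by
  rw [funext Qf_eq]
  fun_prop

lemma continuous_Sf : Continuous Sf := by
  rw [funext Sf_eq]
  fun_prop

lemma continuous_S0f : Continuous S0f :=
  (continuous_Qf.pow 2).sub (continuous_const.mul continuous_Sf)

lemma continuous_nu1r : Continuous nu1r :=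
  (continuous_Qf.add continuous_S0f.sqrt).div_const 2

lemma continuous_nu2r : Continuous nu2r :=
  (continuous_Qf.sub continuous_S0f.sqrt).div_const 2

lemma negPowLocInt_Sf : NegPowLocInt Sf := by
  refine .of_translation (P' := fun p => p.1 0 0 * (p.2 0 0 * p.2 1 1 - p.2 0 1 * p.2 1 0))
    (Matrix.of.symm !![0, 0; 0, 1], 0) continuous_Sf.measurable ?_ ?_
  · intro t p
    simp [Sf_eq]
    ring
  refine .of_translation (P' := fun p => p.1 0 0 * p.2 0 0)
    (0, Matrix.of.symm !![0, 0; 0, 1]) (by fun_prop) ?_ ?_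
  · intro t p
    simp
    ring
  refine .of_translation (P' := fun p => p.2 0 0) (Matrix.of.symm !![1, 0; 0, 0], 0)
    (by fun_prop) ?_ ?_
  · intro t p
    simp
    ring
  refine .of_translation (P' := fun _ => 1) (0, Matrix.of.symm !![1, 0; 0, 0]) (by fun_prop) ?_
    (.const one_ne_zero)
  intro t p
  simp

lemma negPowLocInt_S0f : NegPowLocInt S0f := by
  have hv : Continuous fun z : Fin 2 → Fin 2 → ℝ =>
      (Matrix.of.symm !![-z 1 0, z 0 0; 0, 0] : Fin 2 → Fin 2 → ℝ) := by
    refine continuous_pi fun i => continuous_pi fun j => ?_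
    fin_cases i <;> fin_cases j <;> simp <;> fun_prop
  refine .of_flow (P' := fun p => 4 * (p.2 0 0 * p.2 1 1 - p.2 0 1 * p.2 1 0) *
      (p.2 1 0 * p.1 1 1 + p.2 0 0 * p.1 1 0))
    (v := fun p => (Matrix.of.symm !![-p.2 1 0, p.2 0 0; 0, 0], 0))
    continuous_S0f.measurable ((hv.comp continuous_snd).prodMk continuous_const)
    (measurePreserving_shear hv) ?_ ?_ ?_
  · intro t p
    simp
  · intro t p
    simp [S0f, Sf_eq, Qf_eq]
    ring
  refine .of_translation (P' := fun p => 4 * (p.2 0 0 * p.2 1 1 - p.2 0 1 * p.2 1 0) * p.2 1 0)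
    (Matrix.of.symm !![0, 0; 0, 1], 0) (by fun_prop) ?_ ?_
  · intro t p
    simp
    ring
  refine .of_translation (P' := fun p => 4 * p.2 0 0 * p.2 1 0)
    (0, Matrix.of.symm !![0, 0; 0, 1]) (by fun_prop) ?_ ?_
  · intro t p
    simp
    ring
  refine .of_translation (P' := fun p => 4 * p.2 1 0) (0, Matrix.of.symm !![1, 0; 0, 0])
    (by fun_prop) ?_ ?_
  · intro t p
    simp
    ring
  refine .of_translation (P' := fun _ => 4) (0, Matrix.of.symm !![0, 0; 1, 0]) (by fun_prop) ?_
    (.const (by norm_num))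
  intro t p
  simp
  ring

lemma continuous_tsum_bessel (c : ℕ → ℂ) (hc : ∀ n, ‖c n‖ ≤ 2 * (n + 1)) (lam : ℂ) :
    Continuous fun z : ℂ =>
      ∑' n : ℕ, c n * (lam * z) ^ n / (4 ^ n * (n.factorial : ℂ) ^ 2) := by
  rw [continuous_iff_continuousAt]
  intro z₀
  have hs : Summable fun n : ℕ =>
      2 * ((2 * (‖lam‖ * (‖z₀‖ + 1))) ^ n / (n.factorial : ℝ)) :=
    (Real.summable_pow_div_factorial _).mul_left 2
  refine (continuousOn_tsum (s := Metric.ball 0 (‖z₀‖ + 1)) (fun n => ?_) hs ?_).continuousAt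
    (Metric.isOpen_ball.mem_nhds (by simp))
  · fun_prop
  · intro n z hz
    rw [mem_ball_zero_iff] at hz
    have hn : ((n : ℝ) + 1) ≤ 2 ^ n := by exact_mod_cast Nat.lt_two_pow_self
    have hf : (1 : ℝ) ≤ n.factorial := by exact_mod_cast n.factorial_pos
    have h4 : (1 : ℝ) ≤ 4 ^ n := one_le_pow₀ (by norm_num)
    have hd : (n.factorial : ℝ) ≤ 4 ^ n * (n.factorial : ℝ) ^ 2 := by nlinarith
    rw [norm_div, norm_mul, norm_mul, norm_pow, norm_pow, norm_pow, norm_mul,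
      Complex.norm_natCast, Complex.norm_ofNat, ← mul_div_assoc, mul_pow 2, ← mul_assoc]
    have h2 : ‖c n‖ ≤ 2 * 2 ^ n := (hc n).trans (by linarith)
    gcongr

lemma continuous_Phi (lam : ℂ) : Continuous (Phi lam) := by
  have := continuous_tsum_bessel (fun _ => 1) (fun n => by
    rw [norm_one]
    linarith [n.cast_nonneg (α := ℝ)]) lam
  simp only [one_mul] at this
  exact this

lemma abs_aCoef_le (n : ℕ) : |aCoef n| ≤ 2 * (n + 1) := by
  have hf : (n.factorial : ℝ) ≠ 0 := by exact_mod_cast n.factorial_ne_zero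
  have h1 : aCoef n = -2 * (-Real.eulerMascheroniConstant + harmonic n) := by
    rw [aCoef, Real.deriv_Gamma_nat, Real.Gamma_nat_eq_factorial]
    field_simp
  have h2 : (0 : ℝ) ≤ harmonic n := by
    exact_mod_cast Finset.sum_nonneg fun i _ => by positivity
  have h3 : (harmonic n : ℝ) ≤ n := by
    have : harmonic n ≤ ∑ i ∈ Finset.range n, (1 : ℚ) :=
      Finset.sum_le_sum fun i _ => inv_le_one_of_one_le₀ (by simp)
    have h : harmonic n ≤ n := by simpa using this
    exact_mod_cast h
  have h4 := Real.one_half_lt_eulerMascheroniConstant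
  have h5 := Real.eulerMascheroniConstant_lt_two_thirds
  rw [h1, abs_le]
  constructor <;> linarith

lemma continuous_wFun (lam : ℂ) : Continuous (wFun lam) :=
  continuous_tsum_bessel (fun n => aCoef n) (fun n => by
    simpa using abs_aCoef_le n) lam

/-- Measurable functions which are `O(|t| ^ (-1/6))` on bounded subsets of `ℝ ∖ {0}`. -/
def MildAtZero (A : ℝ → ℂ) : Prop :=
  Measurable A ∧ ∀ M : ℝ, ∃ C : ℝ, 0 ≤ C ∧
    ∀ t : ℝ, t ≠ 0 → |t| ≤ M → ‖A t‖ ≤ C * |t| ^ (-(1 / 6) : ℝ)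

lemma Continuous.mildAtZero {A : ℝ → ℂ} (hA : Continuous A) : MildAtZero A := by
  refine ⟨hA.measurable, fun M => ?_⟩
  obtain ⟨C, hC⟩ := (isCompact_Icc (a := -M) (b := M)).exists_bound_of_continuousOn
    hA.continuousOn
  refine ⟨|C| * |M| ^ (1 / 6 : ℝ), by positivity, fun t ht htM => ?_⟩
  have h0 : 0 < |t| := abs_pos.2 ht
  have h1 : 1 ≤ |M| ^ (1 / 6 : ℝ) * |t| ^ (-(1 / 6) : ℝ) := by
    rw [Real.rpow_neg h0.le, ← div_eq_mul_inv, one_le_div (by positivity)]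
    exact Real.rpow_le_rpow h0.le (htM.trans (le_abs_self M)) (by norm_num)
  calc ‖A t‖ ≤ |C| := (hC t (abs_le.1 htM)).trans (le_abs_self C)
    _ ≤ |C| * (|M| ^ (1 / 6 : ℝ) * |t| ^ (-(1 / 6) : ℝ)) :=
        le_mul_of_one_le_right (abs_nonneg C) h1
    _ = _ := by ring

lemma MildAtZero.add {A B : ℝ → ℂ} (hA : MildAtZero A) (hB : MildAtZero B) :
    MildAtZero fun t => A t + B t := by
  refine ⟨hA.1.add hB.1, fun M => ?_⟩
  obtain ⟨C, hC, hAC⟩ := hA.2 M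
  obtain ⟨D, hD, hBD⟩ := hB.2 M
  refine ⟨C + D, add_nonneg hC hD, fun t ht htM => ?_⟩
  rw [add_mul]
  exact (norm_add_le _ _).trans (add_le_add (hAC t ht htM) (hBD t ht htM))

lemma MildAtZero.mul_continuous {A B : ℝ → ℂ} (hA : MildAtZero A) (hB : Continuous B) :
    MildAtZero fun t => A t * B t := by
  refine ⟨hA.1.mul hB.measurable, fun M => ?_⟩
  obtain ⟨C, hC, hAC⟩ := hA.2 M
  obtain ⟨D, hD⟩ := (isCompact_Icc (a := -M) (b := M)).exists_bound_of_continuousOn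
    hB.continuousOn
  refine ⟨C * |D|, by positivity, fun t ht htM => ?_⟩
  rw [norm_mul, mul_right_comm]
  exact mul_le_mul (hAC t ht htM) ((hD t (abs_le.1 htM)).trans (le_abs_self D)) (norm_nonneg _)
    (by positivity)

lemma mildAtZero_log : MildAtZero fun t => (Real.log |t| : ℂ) := by
  refine ⟨by fun_prop, fun M => ?_⟩
  refine ⟨6 + |M| * |M| ^ (1 / 6 : ℝ), by positivity, fun t ht htM => ?_⟩
  have h0 : 0 < |t| := abs_pos.2 ht
  have h1 : 1 ≤ |M| ^ (1 / 6 : ℝ) * |t| ^ (-(1 / 6) : ℝ) := by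
    rw [Real.rpow_neg h0.le, ← div_eq_mul_inv, one_le_div (by positivity)]
    exact Real.rpow_le_rpow h0.le (htM.trans (le_abs_self M)) (by norm_num)
  have hp : 0 < |t| ^ (-(1 / 6) : ℝ) := by positivity
  rw [Complex.norm_real, Real.norm_eq_abs, abs_le, add_mul]
  have h2 : |t| ≤ |M| := htM.trans (le_abs_self M)
  have h3 : |M| ≤ |M| * |M| ^ (1 / 6 : ℝ) * |t| ^ (-(1 / 6) : ℝ) := by
    rw [mul_assoc]
    exact le_mul_of_one_le_right (abs_nonneg M) h1
  constructor
  · have h4 := Real.log_le_sub_one_of_pos hp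
    rw [Real.log_rpow h0] at h4
    linarith [abs_nonneg M]
  · have h4 := Real.log_le_sub_one_of_pos h0
    linarith

lemma mildAtZero_Phi (lam : ℂ) : MildAtZero fun t : ℝ => Phi lam (t : ℂ) :=
  Continuous.mildAtZero ((continuous_Phi lam).comp Complex.continuous_ofReal)

lemma mildAtZero_Wr (lam : ℂ) : MildAtZero (Wr lam) :=
  (Continuous.mildAtZero ((continuous_wFun lam).comp Complex.continuous_ofReal)).add
    (mildAtZero_log.mul_continuous ((continuous_Phi lam).comp Complex.continuous_ofReal))

lemma rpow_mul_rpow_le_add {x y : ℝ} (hx : 0 < x) (hy : 0 < y) :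
    x ^ (-(1 / 6) : ℝ) * y ^ (-(1 / 2) : ℝ) ≤ x ^ (-(2 / 3) : ℝ) + y ^ (-(2 / 3) : ℝ) := by
  rcases le_total x y with hxy | hxy
  · calc x ^ (-(1 / 6) : ℝ) * y ^ (-(1 / 2) : ℝ)
        ≤ x ^ (-(1 / 6) : ℝ) * x ^ (-(1 / 2) : ℝ) := by
          exact mul_le_mul_of_nonneg_left (Real.rpow_le_rpow_of_nonpos hx hxy (by norm_num))
            (by positivity)
      _ = x ^ (-(2 / 3) : ℝ) := by
          rw [← Real.rpow_add hx]
          norm_num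
      _ ≤ _ := le_add_of_nonneg_right (by positivity)
  · calc x ^ (-(1 / 6) : ℝ) * y ^ (-(1 / 2) : ℝ)
        ≤ y ^ (-(1 / 6) : ℝ) * y ^ (-(1 / 2) : ℝ) := by
          exact mul_le_mul_of_nonneg_right (Real.rpow_le_rpow_of_nonpos hy hxy (by norm_num))
            (by positivity)
      _ = y ^ (-(2 / 3) : ℝ) := by
          rw [← Real.rpow_add hy]
          norm_num
      _ ≤ _ := le_add_of_nonneg_left (by positivity)

lemma nu1r_sub_nu2r (p : V) : nu1r p - nu2r p = Real.sqrt (S0f p) := by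
  unfold nu1r nu2r
  ring

lemma nu1r_mul_nu2r {p : V} (hp : 0 < S0f p) : nu1r p * nu2r p = Sf p := by
  have h := Real.sq_sqrt hp.le
  have h' : S0f p = Qf p ^ 2 - 4 * Sf p := rfl
  unfold nu1r nu2r
  linear_combination -h / 4 - h' / 4

lemma MildAtZero.locallyIntegrable {A B : ℝ → ℂ} (hA : MildAtZero A) (hB : MildAtZero B) :
    LocallyIntegrable (fun p : V =>
      if 0 < S0f p ∧ Sf p ≠ 0 then
        (A (nu1r p) * B (nu2r p) + A (nu2r p) * B (nu1r p)) / (|nu1r p - nu2r p| : ℝ)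
      else 0) volume := by
  rw [locallyIntegrable_iff]
  intro k hk
  obtain ⟨R, hR⟩ := hk.isBounded.subset_closedBall 0
  refine IntegrableOn.mono_set ?_ hR
  have hm1 := continuous_nu1r.measurable
  have hm2 := continuous_nu2r.measurable
  constructor
  · refine (Measurable.ite ?_ ?_ measurable_const).aestronglyMeasurable
    · exact (measurableSet_lt measurable_const continuous_S0f.measurable).inter
        (continuous_Sf.measurable (measurableSet_singleton 0).compl)
    · exact (((hA.1.comp hm1).mul (hB.1.comp hm2)).add ((hA.1.comp hm2).mul (hB.1.comp hm1))).div
        (Complex.measurable_ofReal.comp (hm1.sub hm2).abs)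
  obtain ⟨M₁, hM₁⟩ := (isCompact_closedBall (0 : V) R).exists_bound_of_continuousOn
    continuous_nu1r.continuousOn
  obtain ⟨M₂, hM₂⟩ := (isCompact_closedBall (0 : V) R).exists_bound_of_continuousOn
    continuous_nu2r.continuousOn
  obtain ⟨C, hC, hAC⟩ := hA.2 (max M₁ M₂)
  obtain ⟨D, hD, hBD⟩ := hB.2 (max M₁ M₂)
  have hbound : ∀ p ∈ Metric.closedBall (0 : V) R,
      ‖(if 0 < S0f p ∧ Sf p ≠ 0 then
        (A (nu1r p) * B (nu2r p) + A (nu2r p) * B (nu1r p)) / (|nu1r p - nu2r p| : ℝ)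
      else 0)‖ₑ ≤ ENNReal.ofReal (2 * C * D) * (negPow (Sf p) + negPow (S0f p)) := by
    intro p hp
    split_ifs with h
    · obtain ⟨h0, hS⟩ := h
      have hmul := nu1r_mul_nu2r h0
      have hn1 : nu1r p ≠ 0 := fun h => hS (by rw [← hmul, h, zero_mul])
      have hn2 : nu2r p ≠ 0 := fun h => hS (by rw [← hmul, h, mul_zero])
      have hb1 : |nu1r p| ≤ max M₁ M₂ := (hM₁ p hp).trans (le_max_left _ _)
      have hb2 : |nu2r p| ≤ max M₁ M₂ := (hM₂ p hp).trans (le_max_right _ _)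
      have hprod : |nu1r p| ^ (-(1 / 6) : ℝ) * |nu2r p| ^ (-(1 / 6) : ℝ) =
          |Sf p| ^ (-(1 / 6) : ℝ) := by
        rw [← Real.mul_rpow (abs_nonneg _) (abs_nonneg _), ← abs_mul, hmul]
      have ht1 : ‖A (nu1r p) * B (nu2r p)‖ ≤ C * D * |Sf p| ^ (-(1 / 6) : ℝ) := by
        rw [norm_mul, ← hprod, mul_mul_mul_comm]
        exact mul_le_mul (hAC _ hn1 hb1) (hBD _ hn2 hb2) (norm_nonneg _) (by positivity)
      have ht2 : ‖A (nu2r p) * B (nu1r p)‖ ≤ C * D * |Sf p| ^ (-(1 / 6) : ℝ) := by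
        rw [norm_mul, ← hprod, mul_comm (|nu1r p| ^ _), mul_mul_mul_comm]
        exact mul_le_mul (hAC _ hn2 hb2) (hBD _ hn1 hb1) (norm_nonneg _) (by positivity)
      have hsqrt : (Real.sqrt (S0f p))⁻¹ = S0f p ^ (-(1 / 2) : ℝ) := by
        rw [Real.sqrt_eq_rpow, Real.rpow_neg h0.le]
      rw [negPow_of_ne_zero hS, negPow_of_ne_zero h0.ne',
        ← ENNReal.ofReal_add (by positivity) (by positivity),
        ← ENNReal.ofReal_mul (by positivity), ← ofReal_norm]
      apply ENNReal.ofReal_le_ofReal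
      rw [norm_div, Complex.norm_real, norm_abs_eq_norm, nu1r_sub_nu2r,
        Real.norm_of_nonneg (Real.sqrt_nonneg _), div_eq_mul_inv, hsqrt, abs_of_pos h0]
      calc ‖A (nu1r p) * B (nu2r p) + A (nu2r p) * B (nu1r p)‖ * S0f p ^ (-(1 / 2) : ℝ)
          ≤ (2 * C * D * |Sf p| ^ (-(1 / 6) : ℝ)) * S0f p ^ (-(1 / 2) : ℝ) := by
            gcongr
            linarith [norm_add_le (A (nu1r p) * B (nu2r p)) (A (nu2r p) * B (nu1r p))]
        _ = 2 * C * D * (|Sf p| ^ (-(1 / 6) : ℝ) * S0f p ^ (-(1 / 2) : ℝ)) := by ring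
        _ ≤ _ := by
            gcongr
            exact rpow_mul_rpow_le_add (abs_pos.2 hS) h0
    · simp
  refine lt_of_le_of_lt
    (setLIntegral_mono' Metric.isClosed_closedBall.measurableSet hbound) ?_
  rw [lintegral_const_mul' _ _ ENNReal.ofReal_ne_top,
    lintegral_add_left (f := fun p => negPow (Sf p))
      (measurable_negPow.comp continuous_Sf.measurable)]
  exact ENNReal.mul_lt_top ENNReal.ofReal_lt_top
    (ENNReal.add_lt_top.2 ⟨negPowLocInt_Sf R, negPowLocInt_S0f R⟩)

/-- For each of the four pairs `(A,B)` with `A ∈ {Φ_{λ₁}, W^r_{λ₁}}` and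
`B ∈ {Φ_{λ₂}, W^r_{λ₂}}`, the function `F⁺_{A,B}` is locally integrable on all of `V`. -/
theorem Fplus_locallyIntegrable (l1 l2 : ℂ) (h : l1 * l2 * (l1 - l2) ≠ 0)
    (A B : ℝ → ℂ)
    (hA : A = (fun t : ℝ => Phi l1 (t : ℂ)) ∨ A = Wr l1)
    (hB : B = (fun t : ℝ => Phi l2 (t : ℂ)) ∨ B = Wr l2) :
    LocallyIntegrable (fun p : V =>
      if 0 < S0f p ∧ Sf p ≠ 0 then
        (A (nu1r p) * B (nu2r p) + A (nu2r p) * B (nu1r p)) / (|nu1r p - nu2r p| : ℝ)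
      else 0) volume := by
  have hA' : MildAtZero A := by
    rcases hA with rfl | rfl
    · exact mildAtZero_Phi l1
    · exact mildAtZero_Wr l1
  have hB' : MildAtZero B := by
    rcases hB with rfl | rfl
    · exact mildAtZero_Phi l2
    · exact mildAtZero_Wr l2
  exact hA'.locallyIntegrable hB'
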